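/- Let 1 ≤ n and k ≥ 1 with n + k ≤ g. Let v_1, …, v_n ∈ H satisfy gcd(v_1,…,v_n) = 1, let D be a dual summand for v_1,…,v_n with basis u_1,…,u_n, and set T = (span_ℤ(v_1,…,v_n) + D)^⊥. Let w_1, …, w_k ∈ H be given with gcd(w_1,…,w_k,v_1,…,v_n,u_1,…,u_n) = 1. Then there exist vectors u′_1, …, u′_k ∈ T spanning an isotropic direct summand of H of rank k which is a dual summand for w_1,…,w_k, i.e. ω(w_i,u′_j) = δ_{ij} for all i, j. -/

import Mathlib

namespace Paper

/-- The standard symplectic form on `R^{2g}` with respect to the basis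
`a_1, b_1, …, a_g, b_g` (coordinates `2i, 2i+1` for `a_{i+1}, b_{i+1}`). -/
def symp {R : Type*} [CommRing R] {g : ℕ} (x y : Fin (2 * g) → R) : R :=
  ∑ i : Fin g,
    (x ⟨2 * i.1, by omega⟩ * y ⟨2 * i.1 + 1, by omega⟩ -
      x ⟨2 * i.1 + 1, by omega⟩ * y ⟨2 * i.1, by omega⟩)

theorem symp_add_left {R : Type*} [CommRing R] {g : ℕ} (x y a : Fin (2 * g) → R) :
    symp (x + y) a = symp x a + symp y a := by
  unfold symp
  rw [← Finset.sum_add_distrib]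
  exact Finset.sum_congr rfl fun i _ => by simp only [Pi.add_apply]; ring

theorem symp_smul_left {R : Type*} [CommRing R] {g : ℕ} (c : R) (x a : Fin (2 * g) → R) :
    symp (c • x) a = c * symp x a := by
  unfold symp
  rw [Finset.mul_sum]
  exact Finset.sum_congr rfl fun i _ => by simp only [Pi.smul_apply, smul_eq_mul]; ring

theorem symp_zero_left {R : Type*} [CommRing R] {g : ℕ} (a : Fin (2 * g) → R) :
    symp (0 : Fin (2 * g) → R) a = 0 := by
  unfold symp; simp

/-- The orthogonal complement `A^⊥ = {x | ω(x,a) = 0 for all a ∈ A}`. -/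
def perp {R : Type*} [CommRing R] {g : ℕ} (A : Set (Fin (2 * g) → R)) :
    Submodule R (Fin (2 * g) → R) where
  carrier := {x | ∀ a ∈ A, symp x a = 0}
  add_mem' := by
    intro x y hx hy a ha
    rw [symp_add_left, hx a ha, hy a ha, add_zero]
  zero_mem' := by
    intro a ha
    exact symp_zero_left a
  smul_mem' := by
    intro c x hx a ha
    rw [symp_smul_left, hx a ha, mul_zero]

/-- The submodule of vectors whose first `m` coordinates vanish.
`H_k = coordZero R (2*g) (2*(k-1))`, and `H₂ = coordZero R (2*(g+1)) 2`. -/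
def coordZero (R : Type*) [CommRing R] (n m : ℕ) : Submodule R (Fin n → R) where
  carrier := {v | ∀ j : Fin n, (j : ℕ) < m → v j = 0}
  add_mem' := by
    intro x y hx hy j hj
    have h1 := hx j hj
    have h2 := hy j hj
    simp [Pi.add_apply, h1, h2]
  zero_mem' := by intro j hj; rfl
  smul_mem' := by
    intro c x hx j hj
    have h1 := hx j hj
    simp [Pi.smul_apply, h1]

/-- The standard basis vector `a_{i+1}` (`i` is 0-indexed). -/
def stdA (R : Type*) [CommRing R] (g i : ℕ) : Fin (2 * g) → R :=
  fun j => if (j : ℕ) = 2 * i then 1 else 0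

/-- The standard basis vector `b_{i+1}` (`i` is 0-indexed). -/
def stdB (R : Type*) [CommRing R] (g i : ℕ) : Fin (2 * g) → R :=
  fun j => if (j : ℕ) = 2 * i + 1 then 1 else 0

/-- Regard an integer vector as a rational vector. -/
def qcast {n : ℕ} (v : Fin n → ℤ) : Fin n → ℚ := fun j => (v j : ℚ)

/-- The projection `pr₂` deleting the `a_1`- and `b_1`-coordinates. -/
def pr2 {R : Type*} [CommRing R] {n : ℕ} (v : Fin n → R) : Fin n → R :=
  fun j => if (j : ℕ) < 2 then 0 else v j

/-- `gcd(v_1, …, v_m) = 1`: the vectors are linearly independent and their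
ℤ-span is a direct summand. -/
def IsUnimodular {n m : ℕ} (v : Fin m → Fin n → ℤ) : Prop :=
  LinearIndependent ℤ v ∧
    ∃ C : Submodule ℤ (Fin n → ℤ), IsCompl (Submodule.span ℤ (Set.range v)) C

/-- A primitive vector. -/
def Primitive {n : ℕ} (v : Fin n → ℤ) : Prop := IsUnimodular ![v]

/-- The entries of `w` are pairwise `ω`-orthogonal. -/
def PairwiseOrth {g m : ℕ} (w : Fin m → Fin (2 * g) → ℤ) : Prop :=
  ∀ i j, i ≠ j → symp (w i) (w j) = 0

/-- `Λ³ W`: the span of all wedges of three vectors from `W` inside the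
exterior algebra. -/
def wedge3 {g : ℕ} (W : Submodule ℚ (Fin (2 * g) → ℚ)) :
    Submodule ℚ (ExteriorAlgebra ℚ (Fin (2 * g) → ℚ)) :=
  Submodule.span ℚ {x | ∃ z₁ ∈ W, ∃ z₂ ∈ W, ∃ z₃ ∈ W,
    x = ExteriorAlgebra.ι ℚ z₁ * ExteriorAlgebra.ι ℚ z₂ * ExteriorAlgebra.ι ℚ z₃}

/-- `u ∧ Λ² W`. -/
def uWedge2 {g : ℕ} (u : Fin (2 * g) → ℚ) (W : Submodule ℚ (Fin (2 * g) → ℚ)) :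
    Submodule ℚ (ExteriorAlgebra ℚ (Fin (2 * g) → ℚ)) :=
  Submodule.span ℚ {x | ∃ z₁ ∈ W, ∃ z₂ ∈ W,
    x = ExteriorAlgebra.ι ℚ u * ExteriorAlgebra.ι ℚ z₁ * ExteriorAlgebra.ι ℚ z₂}

/-- `u ∧ u' ∧ W`. -/
def uuWedge1 {g : ℕ} (u u' : Fin (2 * g) → ℚ) (W : Submodule ℚ (Fin (2 * g) → ℚ)) :
    Submodule ℚ (ExteriorAlgebra ℚ (Fin (2 * g) → ℚ)) :=
  Submodule.span ℚ {x | ∃ z ∈ W,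
    x = ExteriorAlgebra.ι ℚ u * ExteriorAlgebra.ι ℚ u' * ExteriorAlgebra.ι ℚ z}

/-- The simplicial differential: on the summand indexed by `w` it sends `z` to
`Σ_j (-1)^j · z` placed in the summand indexed by `∂_j w`. -/
noncomputable def diff (g p : ℕ)
    (ξ : (Fin (p + 1) → Fin (2 * g) → ℤ) →₀ ExteriorAlgebra ℚ (Fin (2 * g) → ℚ)) :
    (Fin p → Fin (2 * g) → ℤ) →₀ ExteriorAlgebra ℚ (Fin (2 * g) → ℚ) :=
  ξ.sum fun w z =>
    ∑ j : Fin (p + 1), ((-1 : ℚ) ^ (j : ℕ)) • Finsupp.single (fun i => w (j.succAbove i)) z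

/-- The gcd of the determinants of all maximal square submatrices of the matrix
whose columns are the `v i`. -/
def vgcd {ι : Type*} [Fintype ι] {m : ℕ} (v : Fin m → ι → ℤ) : ℕ :=
  Finset.univ.gcd fun r : Fin m → ι => (Matrix.det (Matrix.of fun i j => v j (r i))).natAbs

open Module

section Abstract

variable {M : Type*} [AddCommGroup M]

theorem skew_of_alternating (B : M →ₗ[ℤ] M →ₗ[ℤ] ℤ) (hB : ∀ x, B x x = 0) (x y : M) :
    B x y = -B y x := by
  have := hB (x + y)
  simp only [map_add, LinearMap.add_apply, hB] at this
  linarith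

/-- If every vector orthogonal to `y₀` lies in the radical of an alternating form modulo `p`,
then the form vanishes modulo `p`. -/
theorem dvd_of_orthogonal_dvd {N : Type*} [AddCommGroup N] (β : N →ₗ[ℤ] N →ₗ[ℤ] ℤ)
    (hβ : ∀ x, β x x = 0) (y₀ : N) (p : ℤ)
    (h : ∀ x, β x y₀ = 0 → ∀ y, p ∣ β x y) (s t : N) : p ∣ β s t := by
  have hskew := skew_of_alternating β hβ
  obtain ⟨c, hc⟩ := IsPrincipalIdealRing.principal (LinearMap.range (β.flip y₀))
  have hcm : c ∈ LinearMap.range (β.flip y₀) := by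
    rw [hc]; exact Submodule.mem_span_singleton_self c
  obtain ⟨z, hz⟩ := hcm
  rw [LinearMap.flip_apply] at hz
  have hex : ∀ x, ∃ a : ℤ, β x y₀ = a * c := by
    intro x
    have : β.flip y₀ x ∈ LinearMap.range (β.flip y₀) := ⟨x, rfl⟩
    rw [hc, Submodule.mem_span_singleton] at this
    obtain ⟨a, ha⟩ := this
    exact ⟨a, by simpa using ha.symm⟩
  obtain ⟨a, ha⟩ := hex s
  obtain ⟨b, hb⟩ := hex t
  have h1 := h (s - a • z) (by simp [ha, hz]) t
  have h2 := h (t - b • z) (by simp [hb, hz]) z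
  simp only [map_sub, map_smul, LinearMap.sub_apply, LinearMap.smul_apply, smul_eq_mul, hβ,
    mul_zero, sub_zero] at h1 h2
  have h3 : p ∣ β z t := by rw [hskew]; exact (dvd_neg).2 h2
  have h4 := dvd_add h1 (h3.mul_left a)
  simpa using h4

/-- A functional translated by an alternating form takes the value `1` as soon as
there is no obstruction at any prime. -/
theorem exists_add_eq_one {N : Type*} [AddCommGroup N] (β : N →ₗ[ℤ] N →ₗ[ℤ] ℤ)
    (hβ : ∀ x, β x x = 0) (f : N →ₗ[ℤ] ℤ)
    (h : ∀ p : ℕ, p.Prime → (∀ y, (p : ℤ) ∣ f y) → ∃ s t, ¬ (p : ℤ) ∣ β s t) :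
    ∃ x y, f y + β x y = 1 := by
  obtain ⟨x₀, y₀, h₀⟩ : ∃ x y, f y + β x y ≠ 0 := by
    by_contra! hcon
    have hf : ∀ y, f y = 0 := fun y => by simpa using hcon 0 y
    obtain ⟨s, t, hst⟩ := h 2 Nat.prime_two (fun y => by simp [hf])
    apply hst
    have := hcon s t
    rw [hf, zero_add] at this
    simp [this]
  have local_good : ∀ p : ℕ, p.Prime → ∃ x, β x y₀ = 0 ∧
      ∃ y, ¬ (p : ℤ) ∣ f y + β x₀ y + β x y := by
    intro p hp
    by_contra! hcon
    have hF : ∀ y, (p : ℤ) ∣ f y + β x₀ y := fun y => by simpa using hcon 0 (by simp) y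
    have hall : ∀ s t, (p : ℤ) ∣ β s t :=
      dvd_of_orthogonal_dvd β hβ y₀ p fun x hx y => (dvd_add_right (hF y)).1 (hcon x hx y)
    obtain ⟨s, t, hst⟩ := h p hp fun y => (dvd_add_left (hall x₀ y)).1 (hF y)
    exact hst (hall s t)
  have finite_good : ∀ S : Finset ℕ, (∀ p ∈ S, p.Prime) → ∃ x, β x y₀ = 0 ∧
      ∀ p ∈ S, ∃ y, ¬ (p : ℤ) ∣ f y + β x₀ y + β x y := by
    intro S
    induction S using Finset.induction_on with
    | empty => exact fun _ => ⟨0, by simp, by simp⟩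
    | insert p S hpS ih =>
      intro hS
      have hp := hS p (Finset.mem_insert_self p S)
      obtain ⟨x, hx, hgood⟩ := ih fun q hq => hS q (Finset.mem_insert_of_mem hq)
      by_cases hxp : ∃ y, ¬ (p : ℤ) ∣ f y + β x₀ y + β x y
      · exact ⟨x, hx, fun q hq => by
          rcases Finset.mem_insert.1 hq with rfl | hq
          exacts [hxp, hgood q hq]⟩
      · push Not at hxp
        obtain ⟨x', hx', y', hy'⟩ := local_good p hp
        refine ⟨x + (∏ q ∈ S, (q : ℤ)) • (x' - x), by simp [hx, hx'], fun q hq => ?_⟩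
        rcases Finset.mem_insert.1 hq with rfl | hq
        · refine ⟨y', fun hdvd => ?_⟩
          have hP := Nat.prime_iff_prime_int.1 hp
          have e : f y' + β x₀ y' + β (x + (∏ q ∈ S, (q : ℤ)) • (x' - x)) y' =
              (f y' + β x₀ y' + β x y') + (∏ q ∈ S, (q : ℤ)) * β (x' - x) y' := by
            simp; ring
          rw [e, dvd_add_right (hxp y')] at hdvd
          rcases hP.dvd_or_dvd hdvd with hd | hd
          · obtain ⟨r, hr, hqr⟩ := hP.exists_mem_finset_dvd hd
            have := (Nat.prime_dvd_prime_iff_eq hp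
              (hS r (Finset.mem_insert_of_mem hr))).1 (Int.natCast_dvd_natCast.1 hqr)
            exact hpS (this ▸ hr)
          · apply hy'
            have e' : f y' + β x₀ y' + β x' y' =
                (f y' + β x₀ y' + β x y') + β (x' - x) y' := by
              simp
            rw [e']
            exact dvd_add (hxp y') hd
        · obtain ⟨y, hy⟩ := hgood q hq
          refine ⟨y, fun hdvd => hy ?_⟩
          have e : f y + β x₀ y + β (x + (∏ q ∈ S, (q : ℤ)) • (x' - x)) y =
              (f y + β x₀ y + β x y) + (∏ q ∈ S, (q : ℤ)) * β (x' - x) y := by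
            simp; ring
          rw [e] at hdvd
          exact (dvd_add_left ((Finset.dvd_prod_of_mem (fun q : ℕ => (q : ℤ)) hq).mul_right _)).1
            hdvd
  obtain ⟨x, hx, hgood⟩ := finite_good (f y₀ + β x₀ y₀).natAbs.primeFactors
    fun p hp => Nat.prime_of_mem_primeFactors hp
  let F : N →ₗ[ℤ] ℤ := f + β x₀ + β x
  obtain ⟨d, hd⟩ := IsPrincipalIdealRing.principal (LinearMap.range F)
  have hdvd : ∀ y, d ∣ F y := by
    intro y
    have : F y ∈ LinearMap.range F := ⟨y, rfl⟩
    rw [hd, Submodule.mem_span_singleton] at this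
    obtain ⟨a, ha⟩ := this
    exact ⟨a, by rw [← ha, smul_eq_mul, mul_comm]⟩
  have hunit : d.natAbs = 1 := by
    by_contra hne
    obtain ⟨p, hp, hpd⟩ := Nat.exists_prime_and_dvd hne
    have hpd' : (p : ℤ) ∣ d := Int.natCast_dvd.2 hpd
    obtain ⟨y, hy⟩ := hgood p (by
      refine Nat.mem_primeFactors.2 ⟨hp, ?_, Int.natAbs_ne_zero.2 h₀⟩
      have := hpd'.trans (hdvd y₀)
      simp only [F, LinearMap.add_apply, hx, add_zero] at this
      exact Int.natCast_dvd.1 this)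
    exact hy (hpd'.trans (hdvd y))
  have hone : (1 : ℤ) ∈ LinearMap.range F := by
    rw [hd, Submodule.mem_span_singleton]
    rcases Int.natAbs_eq d with e | e
    · exact ⟨1, by rw [e, hunit]; simp⟩
    · exact ⟨-1, by rw [e, hunit]; simp⟩
  obtain ⟨y, hy⟩ := hone
  exact ⟨x₀ + x, y, by simpa [F, add_assoc] using hy⟩

/-- Unimodularity passes to a submodule with an orthogonal projection. -/
theorem represents_of_projection (B : M →ₗ[ℤ] M →ₗ[ℤ] ℤ)
    (hsurj : ∀ f : M →ₗ[ℤ] ℤ, ∃ x, ∀ y, B y x = f y) (T : Submodule ℤ M) (q : M →ₗ[ℤ] M)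
    (hqT : ∀ x, q x ∈ T) (hq : ∀ x ∈ T, q x = x) (hBq : ∀ y ∈ T, ∀ x, B y (q x) = B y x)
    (f : T →ₗ[ℤ] ℤ) : ∃ x : T, ∀ y : T, B y x = f y := by
  obtain ⟨x, hx⟩ := hsurj (f ∘ₗ q.codRestrict T hqT)
  refine ⟨⟨q x, hqT x⟩, fun y => ?_⟩
  rw [hBq y y.2, hx]
  simp only [LinearMap.comp_apply]
  congr 1
  exact Subtype.ext (hq y y.2)

theorem finrank_range_add_finrank_ker_of_int [Module.Finite ℤ M] {M' : Type*} [AddCommGroup M'] (L : M →ₗ[ℤ] M') :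
    finrank ℤ (LinearMap.range L) + finrank ℤ (LinearMap.ker L) = finrank ℤ M := by
  rw [← L.quotKerEquivRange.finrank_eq, Submodule.finrank_quotient_add_finrank]

/-- The orthogonal complement of `k` vectors with a dual family, in a unimodular lattice
of rank at least `2k`, contains no obstruction to completing a dual vector. -/
theorem no_local_obstruction [Module.Free ℤ M] [Module.Finite ℤ M]
    (B : M →ₗ[ℤ] M →ₗ[ℤ] ℤ) (hB : ∀ x, B x x = 0)
    (hsurj : ∀ f : M →ₗ[ℤ] ℤ, ∃ x, ∀ y, B y x = f y) {k : ℕ} (w z : Fin (k + 1) → M)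
    (hwz : ∀ i j, B (w i) (z j) = if i = j then 1 else 0) (hk : 2 * (k + 1) ≤ finrank ℤ M)
    (p : ℕ) (hp : p.Prime) (h0 : ∀ y, (∀ i, B (w i) y = 0) → (p : ℤ) ∣ B (z 0) y) :
    ∃ s t, (∀ i, B (w i) s = 0) ∧ (∀ i, B (w i) t = 0) ∧ ¬ (p : ℤ) ∣ B s t := by
  by_contra! hcon
  let L : M →ₗ[ℤ] (Fin (k + 1) → ℤ) := LinearMap.pi fun i => B (w i)
  have hL : ∀ x, x ∈ LinearMap.ker L ↔ ∀ i, B (w i) x = 0 := fun x => by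
    simp [L, funext_iff]
  have hrank : k + 1 ≤ finrank ℤ (LinearMap.ker L) := by
    have h1 := finrank_range_add_finrank_ker_of_int L
    have h2 : finrank ℤ (LinearMap.range L) ≤ k + 1 := by
      simpa using Submodule.finrank_le (LinearMap.range L)
    omega
  let b := finBasis ℤ (LinearMap.ker L)
  let π : M →ₗ[ℤ] M := LinearMap.id - ∑ i, (B (w i)).smulRight (z i)
  have hπ : ∀ x, π x = x - ∑ i, B (w i) x • z i := fun x => by simp [π]
  have hπL : ∀ x, π x ∈ LinearMap.ker L := by
    intro x
    rw [hL]
    intro i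
    simp [hπ, hwz]
  have hπid : ∀ x ∈ LinearMap.ker L, π x = x := by
    intro x hx
    rw [hL] at hx
    simp [hπ, hx]
  let e : Fin (k + 1) → Fin (finrank ℤ (LinearMap.ker L)) := Fin.castLE hrank
  have hq : ∀ j, ∃ x, ∀ y, B y x = (b.coord (e j) ∘ₗ π.codRestrict _ hπL) y :=
    fun j => hsurj _
  choose q hq using hq
  have hbq : ∀ i j, B (b (e i)) (q j) = if i = j then 1 else 0 := by
    intro i j
    rw [hq, LinearMap.comp_apply]
    have : π.codRestrict _ hπL (b (e i)) = b (e i) := Subtype.ext (hπid _ (b (e i)).2)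
    rw [this, Basis.coord_apply, Basis.repr_self, Finsupp.single_apply]
    simp [e]
  have := Fact.mk hp
  let C : Matrix (Fin (k + 1)) (Fin (k + 1)) (ZMod p) :=
    Matrix.of fun i l => ((B (b (e i)) (z l) : ℤ) : ZMod p)
  let D : Matrix (Fin (k + 1)) (Fin (k + 1)) (ZMod p) :=
    Matrix.of fun l j => ((B (w l) (q j) : ℤ) : ZMod p)
  have hcong : ∀ i x, ((B (b (e i)) x : ℤ) : ZMod p) =
      ∑ l, ((B (b (e i)) (z l) : ℤ) : ZMod p) * ((B (w l) x : ℤ) : ZMod p) := by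
    intro i x
    have h1 := hcon (b (e i)) (π x) ((hL _).1 (b (e i)).2) ((hL _).1 (hπL x))
    rw [← ZMod.intCast_zmod_eq_zero_iff_dvd, hπ] at h1
    simp only [map_sub, map_sum, map_smul, smul_eq_mul, Int.cast_sub, Int.cast_sum,
      Int.cast_mul] at h1
    rw [sub_eq_zero.1 h1]
    exact Finset.sum_congr rfl fun l _ => mul_comm _ _
  have hCD : C * D = 1 := by
    ext i j
    rw [Matrix.mul_apply, Matrix.one_apply]
    simp only [C, D, Matrix.of_apply]
    rw [← hcong, hbq]
    split_ifs <;> simp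
  have hDC : D * C = 1 := mul_eq_one_comm.1 hCD
  have h00 := congrFun (congrFun hDC 0) 0
  rw [Matrix.mul_apply, Matrix.one_apply_eq] at h00
  have hC0 : ∀ i, C i 0 = 0 := by
    intro i
    simp only [C, Matrix.of_apply]
    rw [ZMod.intCast_zmod_eq_zero_iff_dvd, skew_of_alternating B hB, dvd_neg]
    exact h0 _ ((hL _).1 (b (e i)).2)
  simp [hC0] at h00

/-- In a unimodular symplectic lattice of rank at least `2k`, every family of `k` vectors with a
dual family has an isotropic dual family. -/
theorem exists_isotropic_dual (k : ℕ) : ∀ {M : Type*} [AddCommGroup M] [Module.Free ℤ M]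
    [Module.Finite ℤ M] (B : M →ₗ[ℤ] M →ₗ[ℤ] ℤ) (_ : ∀ x, B x x = 0)
    (_ : ∀ f : M →ₗ[ℤ] ℤ, ∃ x, ∀ y, B y x = f y) (w z : Fin k → M)
    (_ : ∀ i j, B (w i) (z j) = if i = j then 1 else 0) (_ : 2 * k ≤ finrank ℤ M),
    ∃ u : Fin k → M, (∀ i j, B (u i) (u j) = 0) ∧
      ∀ i j, B (w i) (u j) = if i = j then 1 else 0 := by
  induction k with
  | zero => exact fun _ _ _ w _ _ _ => ⟨w, fun i => i.elim0, fun i => i.elim0⟩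
  | succ k ih =>
    intro M _ _ _ B hB hsurj w z hwz hk
    have hskew := skew_of_alternating B hB
    obtain ⟨u, y, hwu, hwy, huy⟩ : ∃ u y, (∀ i, B (w i) u = if i = 0 then 1 else 0) ∧
        (∀ i, B (w i) y = 0) ∧ B u y = 1 := by
      let N : Submodule ℤ M := LinearMap.ker (LinearMap.pi fun i => B (w i))
      have hN : ∀ x, x ∈ N ↔ ∀ i, B (w i) x = 0 := fun x => by simp [N, funext_iff]
      obtain ⟨x, y, hxy⟩ := exists_add_eq_one (B.domRestrict₁₂ N N) (fun x => hB x)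
        ((B (z 0)).domRestrict N) (by
          intro p hp h0
          obtain ⟨s, t, hs, ht, hst⟩ := no_local_obstruction B hB hsurj w z hwz hk p hp
            fun y hy => h0 ⟨y, (hN y).2 hy⟩
          exact ⟨⟨s, (hN s).2 hs⟩, ⟨t, (hN t).2 ht⟩, hst⟩)
      refine ⟨z 0 + x, y, fun i => ?_, (hN y).1 y.2, ?_⟩
      · rw [map_add, hwz, (hN x).1 x.2, add_zero]
      · rw [map_add, LinearMap.add_apply]
        exact hxy
    have hwu0 : B (w 0) u = 1 := by simp [hwu]
    have huw0 : B u (w 0) = -1 := by rw [hskew, hwu0]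
    let T : Submodule ℤ M := LinearMap.ker ((B (w 0)).prod (B u))
    have hT : ∀ x, x ∈ T ↔ B (w 0) x = 0 ∧ B u x = 0 := fun x => by simp [T]
    have hrank : 2 * k ≤ finrank ℤ T := by
      have h1 := finrank_range_add_finrank_ker_of_int ((B (w 0)).prod (B u))
      have h2 : finrank ℤ (LinearMap.range ((B (w 0)).prod (B u))) ≤ 2 := by
        simpa using Submodule.finrank_le (LinearMap.range ((B (w 0)).prod (B u)))
      change 2 * k ≤ finrank ℤ (LinearMap.ker ((B (w 0)).prod (B u)))
      omega
    let q : M →ₗ[ℤ] M := LinearMap.id - (B (w 0)).smulRight u + (B u).smulRight (w 0)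
    have hq : ∀ x, q x = x - B (w 0) x • u + B u x • w 0 := fun x => by simp [q]
    have hqT : ∀ x, q x ∈ T := by
      intro x
      rw [hT, hq]
      constructor <;> simp [hB, hwu0, huw0]
    have hqid : ∀ x ∈ T, q x = x := by
      intro x hx
      rw [hT] at hx
      simp [hq, hx.1, hx.2]
    have hTw : ∀ x ∈ T, B x (w 0) = 0 := fun x hx => by rw [hskew, ((hT x).1 hx).1, neg_zero]
    have hTu : ∀ x ∈ T, B x u = 0 := fun x hx => by rw [hskew, ((hT x).1 hx).2, neg_zero]
    have hBq : ∀ y ∈ T, ∀ x, B y (q x) = B y x := by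
      intro y hy x
      simp [hq, hTw y hy, hTu y hy]
    have hqB : ∀ y ∈ T, ∀ x, B (q x) y = B x y := fun y hy x => by
      rw [hskew, hBq y hy, ← hskew]
    have hzT : ∀ j : Fin k, z j.succ - B u (z j.succ) • y ∈ T := by
      intro j
      rw [hT]
      constructor
      · simp [hwz, hwy, (Fin.succ_ne_zero j).symm]
      · simp [huy]
    obtain ⟨u', hiso, hdual⟩ := ih (M := T) (B.domRestrict₁₂ T T) (fun x => hB x)
      (represents_of_projection B hsurj T q hqT hqid hBq)
      (fun i => ⟨q (w i.succ), hqT _⟩) (fun j => ⟨_, hzT j⟩)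
      (by
        intro i j
        change B (q (w i.succ)) (z j.succ - B u (z j.succ) • y) = _
        rw [hqB _ (hzT j)]
        simp [hwz, hwy])
      hrank
    refine ⟨Fin.cons u fun j => u' j, ?_, ?_⟩
    · intro i j
      refine Fin.cases ?_ (fun i => ?_) i <;> refine Fin.cases ?_ (fun j => ?_) j
      · simp [hB]
      · simpa using ((hT _).1 (u' j).2).2
      · simpa using hTu _ (u' i).2
      · exact hiso i j
    · intro i j
      refine Fin.cases ?_ (fun j => ?_) j
      · simpa using hwu i
      · refine Fin.cases ?_ (fun i => ?_) i
        · simpa [(Fin.succ_ne_zero j).symm] using ((hT _).1 (u' j).2).1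
        · have h1 : B (q (w i.succ)) (u' j) = if i = j then 1 else 0 := hdual i j
          rw [hqB _ (u' j).2] at h1
          simpa using h1

end Abstract

theorem symp_self {g : ℕ} (x : Fin (2 * g) → ℤ) : symp x x = 0 :=
  Finset.sum_eq_zero fun i _ => by ring

theorem symp_neg_swap {g : ℕ} (x y : Fin (2 * g) → ℤ) : symp x y = -symp y x := by
  unfold symp
  rw [← Finset.sum_neg_distrib]
  exact Finset.sum_congr rfl fun i _ => by ring

/-- The standard symplectic form as a bilinear map. -/
def sympForm (g : ℕ) : (Fin (2 * g) → ℤ) →ₗ[ℤ] (Fin (2 * g) → ℤ) →ₗ[ℤ] ℤ :=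
  LinearMap.mk₂ ℤ symp symp_add_left symp_smul_left
    (fun x y z => by
      rw [symp_neg_swap, symp_add_left, symp_neg_swap x y, symp_neg_swap x z]; ring)
    (fun c x y => by
      rw [symp_neg_swap, symp_smul_left, symp_neg_swap x y, smul_eq_mul]; ring)

theorem sympForm_apply {g : ℕ} (x y : Fin (2 * g) → ℤ) : sympForm g x y = symp x y := rfl

theorem sum_univ_two_mul : ∀ (g : ℕ) (h : Fin (2 * g) → ℤ),
    ∑ j, h j = ∑ i : Fin g, (h ⟨2 * i.1, by omega⟩ + h ⟨2 * i.1 + 1, by omega⟩) := by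
  intro g
  induction g with
  | zero => intro h; rfl
  | succ g ih =>
    intro h
    rw [Fin.sum_univ_castSucc (n := g)]
    have e : ∑ j, h j = ∑ j : Fin (2 * g + 1 + 1), h ⟨j.1, by omega⟩ := rfl
    rw [e, Fin.sum_univ_castSucc, Fin.sum_univ_castSucc, add_assoc]
    congr 1
    exact ih fun j => h ⟨j.1, by omega⟩

theorem sympForm_represents {g : ℕ} (f : (Fin (2 * g) → ℤ) →ₗ[ℤ] ℤ) :
    ∃ x, ∀ y, sympForm g y x = f y := by
  let c : ℕ → ℤ := fun j => if hj : j < 2 * g then f (Pi.single ⟨j, hj⟩ 1) else 0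
  refine ⟨fun j => if j.1 % 2 = 0 then -c (j.1 + 1) else c (j.1 - 1), fun y => ?_⟩
  have hf : f y = ∑ j, y j * c j := by
    conv_lhs => rw [pi_eq_sum_univ' y, map_sum]
    refine Finset.sum_congr rfl fun j _ => ?_
    rw [map_smul, smul_eq_mul]
    simp only [c, j.2, dif_pos]
  rw [hf, sum_univ_two_mul, sympForm_apply]
  unfold symp
  refine Finset.sum_congr rfl fun i _ => ?_
  have h1 : (2 * i.1 + 1) % 2 ≠ 0 := by omega
  have h2 : (2 * i.1) % 2 = 0 := by omega
  simp only [h2, h1, if_true, if_false, Nat.add_sub_cancel]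
  ring

/-- A unimodular family admits dual functionals. -/
theorem IsUnimodular.exists_dual {n m : ℕ} {v : Fin m → Fin n → ℤ} (hv : IsUnimodular v)
    (j : Fin m) : ∃ f : (Fin n → ℤ) →ₗ[ℤ] ℤ, ∀ i, f (v i) = if i = j then 1 else 0 := by
  obtain ⟨hli, C, hC⟩ := hv
  let b := Basis.span hli
  refine ⟨b.coord j ∘ₗ Submodule.projectionOnto _ C hC, fun i => ?_⟩
  have hb : v i = (b i : Fin n → ℤ) := (congrArg Subtype.val (Basis.span_apply hli i)).symm
  rw [LinearMap.comp_apply, hb, Submodule.projectionOnto_apply_left, Basis.coord_apply,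
    Basis.repr_self, Finsupp.single_apply]

/-- A family admitting dual functionals is unimodular. -/
theorem isUnimodular_of_dual {n m : ℕ} (v : Fin m → Fin n → ℤ)
    (f : Fin m → (Fin n → ℤ) →ₗ[ℤ] ℤ) (h : ∀ i j, f i (v j) = if i = j then 1 else 0) :
    IsUnimodular v := by
  have hsum : ∀ (c : Fin m → ℤ) i, f i (∑ j, c j • v j) = c i := by
    intro c i
    simp [-zsmul_eq_mul, h]
  refine ⟨Fintype.linearIndependent_iff.2 fun c hc i => by rw [← hsum c i, hc, map_zero],
    LinearMap.ker (LinearMap.pi f), ?_⟩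
  rw [isCompl_iff, Submodule.disjoint_def, codisjoint_iff, Submodule.eq_top_iff']
  constructor
  · intro x hx hx'
    obtain ⟨c, rfl⟩ := (Submodule.mem_span_range_iff_exists_fun ℤ).1 hx
    have hc : ∀ i, c i = 0 := fun i => by
      rw [← hsum c i]
      exact congrFun (LinearMap.mem_ker.1 hx') i
    simp [hc]
  · intro x
    refine Submodule.mem_sup.2 ⟨∑ j, f j x • v j, ?_, x - ∑ j, f j x • v j, ?_, by abel⟩
    · exact (Submodule.mem_span_range_iff_exists_fun ℤ).2 ⟨_, rfl⟩
    · rw [LinearMap.mem_ker]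
      ext i
      simp only [LinearMap.pi_apply, map_sub, hsum, sub_self, Pi.zero_apply]

/-- a dual summand inside `T = (S + D)^⊥`, Prop. 2.11 (iii). -/
theorem stmt6 (g n k : ℕ) (hn : 1 ≤ n) (hk : 1 ≤ k) (hg : n + k ≤ g)
    (v : Fin n → Fin (2 * g) → ℤ) (hv : IsUnimodular v)
    (u : Fin n → Fin (2 * g) → ℤ) (hu : IsUnimodular u)
    (huiso : ∀ i j, symp (u i) (u j) = 0)
    (hdual : ∀ i j, symp (v i) (u j) = if i = j then 1 else 0)
    (w : Fin k → Fin (2 * g) → ℤ)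
    (hall : IsUnimodular (Fin.append w (Fin.append v u))) :
    ∃ u' : Fin k → Fin (2 * g) → ℤ,
      (∀ j, u' j ∈ perp ((Submodule.span ℤ (Set.range v) ⊔ Submodule.span ℤ (Set.range u) :
        Submodule ℤ (Fin (2 * g) → ℤ)) : Set (Fin (2 * g) → ℤ))) ∧
      IsUnimodular u' ∧
      (∀ i j, symp (u' i) (u' j) = 0) ∧
      (∀ i j, symp (w i) (u' j) = if i = j then 1 else 0) := by
  let B := sympForm g
  have hB : ∀ x, B x x = 0 := symp_self
  have hskew := skew_of_alternating B hB
  have huu : ∀ i j, B (u i) (u j) = 0 := huiso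
  have hvu : ∀ i j, B (v i) (u j) = if i = j then 1 else 0 := hdual
  have huv : ∀ i j, B (u i) (v j) = if i = j then -1 else 0 := fun i j => by
    rw [hskew, hvu]
    by_cases h : i = j
    · simp [h]
    · simp [h, Ne.symm h]
  let L := (LinearMap.pi fun i => B (v i)).prod (LinearMap.pi fun i => B (u i))
  let T : Submodule ℤ (Fin (2 * g) → ℤ) := LinearMap.ker L
  have hT : ∀ x, x ∈ T ↔ (∀ i, B (v i) x = 0) ∧ ∀ i, B (u i) x = 0 := fun x => by
    simp [T, L, funext_iff]
  have hrank : 2 * k ≤ finrank ℤ T := by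
    have h1 := finrank_range_add_finrank_ker_of_int L
    have h2 : finrank ℤ (LinearMap.range L) ≤ n + n := by
      simpa using Submodule.finrank_le (LinearMap.range L)
    have h3 : finrank ℤ (Fin (2 * g) → ℤ) = 2 * g := by simp
    change 2 * k ≤ finrank ℤ (LinearMap.ker L)
    omega
  let β : Fin n → (Fin (2 * g) → ℤ) →ₗ[ℤ] ℤ := fun j =>
    B (v j) + ∑ i, B (v j) (v i) • B (u i)
  let q : (Fin (2 * g) → ℤ) →ₗ[ℤ] (Fin (2 * g) → ℤ) :=
    LinearMap.id + ∑ i, (B (u i)).smulRight (v i) - ∑ i, (β i).smulRight (u i)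
  have hq : ∀ x, q x = x + ∑ i, B (u i) x • v i - ∑ i, β i x • u i := fun x => by simp [q]
  have hqT : ∀ x, q x ∈ T := by
    intro x
    rw [hT, hq]
    constructor
    · intro j
      simp only [map_add, map_sub, map_sum, map_smul, smul_eq_mul, hvu, mul_ite, mul_one,
        mul_zero, Finset.sum_ite_eq, Finset.mem_univ, if_true]
      simp [β, mul_comm]
    · intro j
      simp [-zsmul_eq_mul, huv, huu]
  have hqid : ∀ x ∈ T, q x = x := by
    intro x hx
    rw [hT] at hx
    simp [hq, β, hx.1, hx.2]
  have hTv : ∀ x ∈ T, ∀ i, B x (v i) = 0 := fun x hx i => by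
    rw [hskew, ((hT x).1 hx).1, neg_zero]
  have hTu : ∀ x ∈ T, ∀ i, B x (u i) = 0 := fun x hx i => by
    rw [hskew, ((hT x).1 hx).2, neg_zero]
  have hBq : ∀ y ∈ T, ∀ x, B y (q x) = B y x := by
    intro y hy x
    simp [-zsmul_eq_mul, hq, hTv y hy, hTu y hy]
  have hqB : ∀ y ∈ T, ∀ x, B (q x) y = B x y := fun y hy x => by
    rw [hskew, hBq y hy, ← hskew]
  have hz : ∀ j : Fin k, ∃ z ∈ T, ∀ i, B (w i) z = if i = j then 1 else 0 := by
    intro j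
    obtain ⟨f, hf⟩ := hall.exists_dual (Fin.castAdd (n + n) j)
    obtain ⟨z, hz⟩ := sympForm_represents f
    refine ⟨z, (hT z).2 ⟨fun i => ?_, fun i => ?_⟩, fun i => ?_⟩
    · have := hf (Fin.natAdd k (Fin.castAdd n i))
      rw [Fin.append_right, Fin.append_left, ← hz] at this
      rw [this, if_neg]
      simp only [Fin.ext_iff, Fin.val_natAdd, Fin.val_castAdd]
      omega
    · have := hf (Fin.natAdd k (Fin.natAdd n i))
      rw [Fin.append_right, Fin.append_right, ← hz] at this
      rw [this, if_neg]
      simp only [Fin.ext_iff, Fin.val_natAdd, Fin.val_castAdd]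
      omega
    · have := hf (Fin.castAdd (n + n) i)
      rw [Fin.append_left, ← hz] at this
      simpa using this
  choose z hzT hwz using hz
  obtain ⟨u', hiso, hdual'⟩ := exists_isotropic_dual k (M := T) (B.domRestrict₁₂ T T)
    (fun x => hB x) (represents_of_projection B sympForm_represents T q hqT hqid hBq)
    (fun i => ⟨q (w i), hqT _⟩) (fun j => ⟨z j, hzT j⟩)
    (fun i j => (hqB _ (hzT j) _).trans (hwz j i)) hrank
  have hwu' : ∀ i j, B (w i) (u' j) = if i = j then 1 else 0 := fun i j =>
    (hqB _ (u' j).2 _).symm.trans (hdual' i j)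
  refine ⟨fun j => u' j, fun j => ?_, isUnimodular_of_dual _ (fun i => B (w i)) hwu', hiso, hwu'⟩
  have hle : Submodule.span ℤ (Set.range v) ⊔ Submodule.span ℤ (Set.range u) ≤
      LinearMap.ker (B (u' j)) := by
    refine sup_le ?_ ?_ <;> rw [Submodule.span_le] <;> rintro _ ⟨i, rfl⟩
    exacts [hTv _ (u' j).2 i, hTu _ (u' j).2 i]
  exact fun a ha => hle ha

end Paper
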